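/- Suppose that every residue R of type J with |J| = 2 (in either half C₊ or C₋) admits direct descent into R^θ and that R^θ is connected for every such R. Fix ε ∈ {+,−} and write C^θ := (C_ε)^θ for the flip-flop system of C_ε. Then there exists a spherical subset K ⊆ S with θ(K) = K such that: every minimal Phan residue of C_ε has type K; δ^θ(c) = w_K for every c ∈ C^θ; C^θ equals the union of the minimal Phan residues of C_ε; and C^θ inherits connectedness from C_ε, i.e., for every J ⊆ S and all c, d ∈ C^θ, if c and d are joined by a J-gallery in C_ε then they are joined by a J-gallery in C^θ. -/

import Mathlib

universe u v

/-- A twin building of type `(W,S)` (where `S` is the set of simple reflections of the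
Coxeter system `cs`), with positive half `Cp` and negative half `Cm`, distance functions
`δp`, `δm`, codistance `δst : Cp × Cm → W`, `δts : Cm × Cp → W`, together with a
quasi-flip: maps `θp : Cp → Cm`, `θm : Cm → Cp` inverse to each other and an automorphism
`π` of `W` with `π(S) = S`, `π ∘ π = id`, compatible with the distances and the
codistance. -/
structure QuasiFlipTwinBuilding {B : Type*} {W : Type*} [Group W]
    (M : CoxeterMatrix B) (cs : CoxeterSystem M W)
    (Cp : Type u) (Cm : Type v) where
  δp : Cp → Cp → W
  δm : Cm → Cm → W
  δst : Cp → Cm → W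
  δts : Cm → Cp → W
  θp : Cp → Cm
  θm : Cm → Cp
  π : W ≃* W
  nonempty_p : Nonempty Cp
  nonempty_m : Nonempty Cm
  /-- (Bu1) for the positive half -/
  p_eq_one_iff : ∀ x y : Cp, δp x y = 1 ↔ x = y
  /-- (Bu1) for the negative half -/
  m_eq_one_iff : ∀ x y : Cm, δm x y = 1 ↔ x = y
  /-- (Bu2) for the positive half -/
  p_two : ∀ (x y z : Cp) (s : W), s ∈ Set.range cs.simple → δp y z = s →
    δp x z = δp x y ∨ δp x z = δp x y * s
  p_two' : ∀ (x y z : Cp) (s : W), s ∈ Set.range cs.simple → δp y z = s →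
    cs.length (δp x y * s) = cs.length (δp x y) + 1 → δp x z = δp x y * s
  /-- (Bu2) for the negative half -/
  m_two : ∀ (x y z : Cm) (s : W), s ∈ Set.range cs.simple → δm y z = s →
    δm x z = δm x y ∨ δm x z = δm x y * s
  m_two' : ∀ (x y z : Cm) (s : W), s ∈ Set.range cs.simple → δm y z = s →
    cs.length (δm x y * s) = cs.length (δm x y) + 1 → δm x z = δm x y * s
  /-- (Bu3) for the positive half -/
  p_three : ∀ (x y : Cp) (s : W), s ∈ Set.range cs.simple →
    ∃ z : Cp, δp y z = s ∧ δp x z = δp x y * s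
  /-- (Bu3) for the negative half -/
  m_three : ∀ (x y : Cm) (s : W), s ∈ Set.range cs.simple →
    ∃ z : Cm, δm y z = s ∧ δm x z = δm x y * s
  /-- (Tw1) -/
  tw1 : ∀ (x : Cp) (y : Cm), δts y x = (δst x y)⁻¹
  /-- (Tw2), positive-to-negative -/
  tw2p : ∀ (x : Cp) (y z : Cm) (s : W), s ∈ Set.range cs.simple → δm y z = s →
    cs.length (δst x y * s) + 1 = cs.length (δst x y) → δst x z = δst x y * s
  /-- (Tw2), negative-to-positive -/
  tw2m : ∀ (x : Cm) (y z : Cp) (s : W), s ∈ Set.range cs.simple → δp y z = s →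
    cs.length (δts x y * s) + 1 = cs.length (δts x y) → δts x z = δts x y * s
  /-- (Tw3), positive-to-negative -/
  tw3p : ∀ (x : Cp) (y : Cm) (s : W), s ∈ Set.range cs.simple →
    ∃ z : Cm, δm y z = s ∧ δst x z = δst x y * s
  /-- (Tw3), negative-to-positive -/
  tw3m : ∀ (x : Cm) (y : Cp) (s : W), s ∈ Set.range cs.simple →
    ∃ z : Cp, δp y z = s ∧ δts x z = δts x y * s
  /-- `θ ∘ θ = id` -/
  θmθp : ∀ c : Cp, θm (θp c) = c
  θpθm : ∀ c : Cm, θp (θm c) = c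
  /-- `π(S) = S` -/
  πS : ⇑π '' Set.range cs.simple = Set.range cs.simple
  /-- `π ∘ π = id` -/
  ππ : ∀ w : W, π (π w) = w
  /-- `θ` interchanges the distances via `π` -/
  flip_p : ∀ x y : Cp, δm (θp x) (θp y) = π (δp x y)
  flip_m : ∀ x y : Cm, δp (θm x) (θm y) = π (δm x y)
  /-- `θ` preserves the codistance via `π` -/
  flip_st : ∀ (x : Cp) (z : Cm), δts (θp x) (θm z) = π (δst x z)
  flip_ts : ∀ (x : Cm) (z : Cp), δst (θm x) (θp z) = π (δts x z)

namespace QuasiFlipTwinBuilding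

variable {B : Type*} {W : Type*} [Group W] {M : CoxeterMatrix B} {cs : CoxeterSystem M W}
  {Cp : Type u} {Cm : Type v}

/-- The same twin building with a quasi-flip, with the roles of the two halves
interchanged. -/
def swap (T : QuasiFlipTwinBuilding M cs Cp Cm) : QuasiFlipTwinBuilding M cs Cm Cp where
  δp := T.δm
  δm := T.δp
  δst := T.δts
  δts := T.δst
  θp := T.θm
  θm := T.θp
  π := T.π
  nonempty_p := T.nonempty_m
  nonempty_m := T.nonempty_p
  p_eq_one_iff := T.m_eq_one_iff
  m_eq_one_iff := T.p_eq_one_iff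
  p_two := T.m_two
  p_two' := T.m_two'
  m_two := T.p_two
  m_two' := T.p_two'
  p_three := T.m_three
  m_three := T.p_three
  tw1 := fun x y => by rw [T.tw1 y x, inv_inv]
  tw2p := T.tw2m
  tw2m := T.tw2p
  tw3p := T.tw3m
  tw3m := T.tw3p
  θmθp := T.θpθm
  θpθm := T.θmθp
  πS := T.πS
  ππ := T.ππ
  flip_p := T.flip_m
  flip_m := T.flip_p
  flip_st := T.flip_ts
  flip_ts := T.flip_st

variable (T : QuasiFlipTwinBuilding M cs Cp Cm)

/-- The `θ`-codistance `δ^θ(c) = δ*(c, θ(c))` of a chamber of the positive half. -/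
def δθ (c : Cp) : W := T.δst c (T.θp c)

/-- The numerical `θ`-codistance `ℓ^θ(c) = ℓ(δ^θ(c))`. -/
noncomputable def ℓθ (c : Cp) : ℕ := cs.length (T.δθ c)

/-- The `s`-panel of a chamber `c`. -/
def panel (s : W) (c : Cp) : Set Cp := {d | T.δp c d = 1 ∨ T.δp c d = s}

/-- The `J`-residue of a chamber `c`. -/
def residue (J : Set W) (c : Cp) : Set Cp := {d | T.δp c d ∈ Subgroup.closure J}

/-- Opposition of chambers: `δ*(c,d) = 1`. -/
def Opp (c : Cp) (d : Cm) : Prop := T.δst c d = 1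

/-- `R` is a Phan residue of type `J`: `R` is a `J`-residue, every chamber of `R` is
opposite some chamber of `θ(R)`, and every chamber of `θ(R)` is opposite some chamber
of `R`. -/
def IsPhan (J : Set W) (R : Set Cp) : Prop :=
  (∃ c : Cp, R = T.residue J c) ∧
  (∀ r ∈ R, ∃ r' ∈ R, T.Opp r (T.θp r')) ∧
  (∀ r' ∈ R, ∃ r ∈ R, T.Opp r (T.θp r'))

/-- `R` is a minimal Phan residue of type `J`: it is a Phan residue containing no Phan
residue as a proper subset. -/
def IsMinPhan (J : Set W) (R : Set Cp) : Prop :=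
  T.IsPhan J R ∧ ∀ (J' : Set W) (R' : Set Cp), J' ⊆ Set.range cs.simple →
    T.IsPhan J' R' → R' ⊆ R → R' = R

/-- Two chambers are `J`-adjacent: they are `j`-adjacent for some `j ∈ J`. -/
def adjJ (J : Set W) (c d : Cp) : Prop := ∃ j ∈ J, T.δp c d = 1 ∨ T.δp c d = j

/-- There is a `J`-gallery from `c` to `d` all of whose chambers lie in `X`. -/
def GalleryIn (X : Set Cp) (J : Set W) (c d : Cp) : Prop :=
  ∃ γ : List Cp, γ.head? = some c ∧ γ.getLast? = some d ∧
    γ.Chain' (T.adjJ J) ∧ ∀ x ∈ γ, x ∈ X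

/-- The flip-flop system of a set `R` of chambers: the chambers of `R` whose numerical
`θ`-codistance is minimal among chambers of `R`. -/
def flipflop (R : Set Cp) : Set Cp := {c ∈ R | ∀ d ∈ R, T.ℓθ c ≤ T.ℓθ d}

/-- The flip-flop system `R^θ` is connected: any two of its chambers are joined by a
gallery all of whose chambers lie in `R^θ`. -/
def ConnectedFF (R : Set Cp) : Prop :=
  ∀ c ∈ T.flipflop R, ∀ d ∈ T.flipflop R,
    T.GalleryIn (T.flipflop R) (Set.range cs.simple) c d

/-- `R` admits direct descent into `R^θ`: from every chamber of `R` there is a gallery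
within `R` ending in `R^θ` along which the numerical `θ`-codistance strictly decreases. -/
def DirectDescent (R : Set Cp) : Prop :=
  ∀ c ∈ R, ∃ γ : List Cp, γ.head? = some c ∧
    (∃ e, γ.getLast? = some e ∧ e ∈ T.flipflop R) ∧
    γ.Chain' (T.adjJ (Set.range cs.simple)) ∧
    γ.Chain' (fun a b => T.ℓθ b < T.ℓθ a) ∧
    ∀ x ∈ γ, x ∈ R

/-- The quasi-flip is strong on this half: for every chamber `c` and every `s ∈ S` there
are chambers `d, x` in the `s`-panel of `c` with `ℓ(δ*(x, θ(d))) > ℓ(δ*(d, θ(d)))`,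
i.e. the projection of `θ(d)` onto the panel is not `d`. -/
def IsStrongHalf : Prop :=
  ∀ (c : Cp) (s : W), s ∈ Set.range cs.simple →
    ∃ d ∈ T.panel s c, ∃ x ∈ T.panel s c,
      cs.length (T.δst d (T.θp d)) < cs.length (T.δst x (T.θp d))

end QuasiFlipTwinBuilding

namespace CoxeterSystem

variable {B : Type*} {W : Type*} [Group W] {M : CoxeterMatrix B} (cs : CoxeterSystem M W)

open Classical in
/-- The permutation of `W × ZMod 2` by which the simple reflection `s i` acts: conjugation on
the first factor, flipping the sign exactly when the first component is `s i`. -/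
noncomputable def signedConj (i : B) : Equiv.Perm (W × ZMod 2) :=
  Function.Involutive.toPerm
    (fun p => (cs.simple i * p.1 * cs.simple i, p.2 + if p.1 = cs.simple i then 1 else 0)) <| by
    rintro ⟨t, ε⟩
    have h : cs.simple i * t * cs.simple i = cs.simple i ↔ t = cs.simple i := by
      constructor
      · intro h
        have := congrArg (fun x => cs.simple i * x * cs.simple i) h
        simpa [mul_assoc] using this
      · rintro rfl; simp
    ext1
    · simp [mul_assoc]
    · simp only [h]
      split_ifs
      · rw [add_assoc, CharTwo.add_self_eq_zero, add_zero]
      · simp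

open Classical in
theorem signedConj_apply (i : B) (p : W × ZMod 2) :
    cs.signedConj i p =
      (cs.simple i * p.1 * cs.simple i, p.2 + if p.1 = cs.simple i then 1 else 0) := rfl

open Classical in
theorem signedConj_mul_pow_apply (i j : B) (k : ℕ) (t : W) (ε : ZMod 2) :
    ((cs.signedConj i * cs.signedConj j) ^ k) (t, ε) =
      ((cs.simple i * cs.simple j) ^ k * t * ((cs.simple i * cs.simple j) ^ k)⁻¹,
        ε + ∑ n ∈ Finset.range (2 * k),
          if t = cs.simple j * (cs.simple i * cs.simple j) ^ n then 1 else 0) := by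
  induction k with
  | zero => simp
  | succ k ih =>
    set r := cs.simple i * cs.simple j with hr
    have hinv : r⁻¹ = cs.simple j * cs.simple i := by simp [hr]
    have hconj : ∀ n : ℕ, r ^ n * (cs.simple j * r ^ n) = cs.simple j := by
      intro n
      induction n with
      | zero => simp
      | succ n ihn =>
        calc r ^ (n + 1) * (cs.simple j * r ^ (n + 1))
            = r * (r ^ n * (cs.simple j * r ^ n)) * r := by
              rw [pow_succ' r n]; nth_rewrite 2 [← pow_succ']; rw [pow_succ r n]; group
          _ = cs.simple j := by rw [ihn, hr]; simp [mul_assoc]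
    have e1 : r ^ k * t * (r ^ k)⁻¹ = cs.simple j ↔ t = cs.simple j * r ^ (2 * k) := by
      rw [mul_inv_eq_iff_eq_mul, ← eq_inv_mul_iff_mul_eq]
      have : (r ^ k)⁻¹ * (cs.simple j * r ^ k) = cs.simple j * r ^ (2 * k) := by
        rw [inv_mul_eq_iff_eq_mul, two_mul, pow_add, ← mul_assoc (cs.simple j), ← mul_assoc, hconj]
      rw [this]
    have e2 : cs.simple j * (r ^ k * t * (r ^ k)⁻¹) * cs.simple j = cs.simple i ↔
        t = cs.simple j * r ^ (2 * k + 1) := by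
      have h1 : cs.simple j * (r ^ k * t * (r ^ k)⁻¹) * cs.simple j = cs.simple i ↔
          r ^ k * t * (r ^ k)⁻¹ = cs.simple j * r := by
        constructor
        · intro h
          have := congrArg (fun x => cs.simple j * x * cs.simple j) h
          simpa [mul_assoc, hr] using this
        · intro h
          rw [h, hr]; simp [mul_assoc]
      rw [h1, mul_inv_eq_iff_eq_mul, ← eq_inv_mul_iff_mul_eq]
      have : (r ^ k)⁻¹ * (cs.simple j * r * r ^ k) = cs.simple j * r ^ (2 * k + 1) := by
        rw [inv_mul_eq_iff_eq_mul, mul_assoc, ← pow_succ',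
          show 2 * k + 1 = k + (k + 1) by ring, pow_add r k (k + 1), ← mul_assoc (cs.simple j),
          ← mul_assoc, hconj]
      rw [this]
    rw [pow_succ', Equiv.Perm.mul_apply, ih, Equiv.Perm.mul_apply, cs.signedConj_apply j,
      cs.signedConj_apply i]
    dsimp only
    ext1
    · dsimp only
      rw [pow_succ' r k, mul_inv_rev, hinv, hr]
      simp only [mul_assoc]
    · dsimp only
      rw [show 2 * (k + 1) = 2 * k + 1 + 1 by ring, Finset.sum_range_succ, Finset.sum_range_succ]
      simp only [e1, e2]
      ring

theorem isLiftable_signedConj : M.IsLiftable cs.signedConj := by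
  classical
  intro i j
  ext1 ⟨t, ε⟩
  rw [signedConj_mul_pow_apply, two_mul, Finset.sum_range_add]
  simp [pow_add, CharTwo.add_self_eq_zero]

/-- The action of `W` on `W × ZMod 2` whose sign component counts inversions modulo two. -/
noncomputable def signedConjHom : W →* Equiv.Perm (W × ZMod 2) :=
  cs.lift ⟨cs.signedConj, cs.isLiftable_signedConj⟩

theorem signedConjHom_simple (i : B) : cs.signedConjHom (cs.simple i) = cs.signedConj i :=
  cs.lift_apply_simple cs.isLiftable_signedConj i

open Classical in
theorem signedConjHom_wordProd (ω : List B) (t : W) (ε : ZMod 2) :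
    cs.signedConjHom (cs.wordProd ω) (t, ε) =
      (cs.wordProd ω * t * (cs.wordProd ω)⁻¹, ε + (cs.rightInvSeq ω).count t) := by
  induction ω with
  | nil => simp
  | cons i ω ih =>
    rw [cs.wordProd_cons, map_mul, Equiv.Perm.mul_apply, ih, signedConjHom_simple,
      signedConj_apply]
    ext1
    · simp [mul_assoc]
    · have h : cs.wordProd ω * t * (cs.wordProd ω)⁻¹ = cs.simple i ↔
          (cs.wordProd ω)⁻¹ * cs.simple i * cs.wordProd ω = t := by
        rw [mul_inv_eq_iff_eq_mul, mul_assoc, inv_mul_eq_iff_eq_mul, eq_comm]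
      simp only [rightInvSeq, List.count_cons, h, beq_iff_eq]
      push_cast
      ring

theorem simple_mem_rightInvSeq {ω : List B} {i : B}
    (h : cs.IsRightDescent (cs.wordProd ω) i) : cs.simple i ∈ cs.rightInvSeq ω := by
  classical
  obtain ⟨ω', hω', he⟩ := cs.exists_isReduced (cs.wordProd ω * cs.simple i)
  have hmem : cs.simple i ∉ cs.rightInvSeq ω' := by
    intro hm
    have := (cs.isRightInversion_of_mem_rightInvSeq hω' hm).2
    rw [← he] at this
    rw [IsRightDescent] at h
    simp only [simple_mul_simple_cancel_right] at this
    omega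
  have h1 := cs.signedConjHom_wordProd ω (cs.simple i) 0
  have h2 : cs.wordProd ω = cs.wordProd ω' * cs.simple i := by rw [← he]; simp
  nth_rewrite 1 [h2] at h1
  rw [map_mul, Equiv.Perm.mul_apply, signedConjHom_simple, signedConj_apply,
    signedConjHom_wordProd] at h1
  dsimp only at h1
  rw [simple_mul_simple_self, one_mul, List.count_eq_zero_of_not_mem hmem] at h1
  have h3 := congrArg Prod.snd h1
  by_contra hn
  rw [List.count_eq_zero_of_not_mem hn] at h3
  simp at h3

theorem simple_mem_leftInvSeq {ω : List B} {i : B}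
    (h : cs.IsLeftDescent (cs.wordProd ω) i) : cs.simple i ∈ cs.leftInvSeq ω := by
  have h1 : cs.IsRightDescent (cs.wordProd ω.reverse) i := by
    rwa [wordProd_reverse, isRightDescent_inv_iff]
  simpa [rightInvSeq_reverse] using cs.simple_mem_rightInvSeq h1

/-- The exchange condition. -/
theorem exists_simple_mul_wordProd_eq_eraseIdx {ω : List B} {i : B}
    (h : cs.IsLeftDescent (cs.wordProd ω) i) :
    ∃ j < ω.length, cs.simple i * cs.wordProd ω = cs.wordProd (ω.eraseIdx j) := by
  obtain ⟨j, hj, he⟩ := List.getElem_of_mem (cs.simple_mem_leftInvSeq h)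
  have hj' : j < ω.length := by simpa using hj
  refine ⟨j, hj', ?_⟩
  rw [← cs.getD_leftInvSeq_mul_wordProd ω j, List.getD_eq_getElem _ _ hj, he]

theorem simple_mul_eq_mul_simple_of_lt {w : W} {i j : B}
    (hij : cs.length (cs.simple i * w) = cs.length (w * cs.simple j))
    (hw : cs.length (cs.simple i * w * cs.simple j) = cs.length w)
    (hlt : cs.length w < cs.length (w * cs.simple j)) :
    cs.simple i * w = w * cs.simple j := by
  obtain ⟨ω, hω, rfl⟩ := cs.exists_isReduced w
  have hd : cs.IsLeftDescent (cs.wordProd (ω.concat j)) i := by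
    rw [IsLeftDescent, wordProd_concat, ← mul_assoc]; omega
  have hm := cs.simple_mem_leftInvSeq hd
  rw [leftInvSeq_concat, List.concat_eq_append, List.mem_append, List.mem_singleton] at hm
  rcases hm with hm | hm
  · have := (cs.isLeftInversion_of_mem_leftInvSeq hω hm).2
    omega
  · rw [hm]; group

/-- The folding condition. -/
theorem simple_mul_eq_mul_simple {w : W} {i j : B}
    (hij : cs.length (cs.simple i * w) = cs.length (w * cs.simple j))
    (hw : cs.length (cs.simple i * w * cs.simple j) = cs.length w) :
    cs.simple i * w = w * cs.simple j := by
  rcases cs.length_mul_simple w j with h | h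
  · exact cs.simple_mul_eq_mul_simple_of_lt hij hw (by omega)
  · have := cs.simple_mul_eq_mul_simple_of_lt (w := w * cs.simple j) (i := i) (j := j)
      (by rw [← mul_assoc, hw]; simp) (by rw [← mul_assoc]; simp [hij]) (by simp; omega)
    rw [simple_mul_simple_cancel_right, ← mul_assoc] at this
    nth_rewrite 2 [← this]
    simp

variable {J : Set W}

theorem wordProd_mem_closure {ω : List B} (h : ∀ i ∈ ω, cs.simple i ∈ J) :
    cs.wordProd ω ∈ Subgroup.closure J := by
  refine Subgroup.list_prod_mem _ fun x hx => ?_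
  obtain ⟨i, hi, rfl⟩ := List.mem_map.1 hx
  exact Subgroup.subset_closure (h i hi)

theorem exists_wordProd_eq_of_mem_closure (hJ : J ⊆ Set.range cs.simple) {w : W}
    (hw : w ∈ Subgroup.closure J) :
    ∃ ω : List B, (∀ i ∈ ω, cs.simple i ∈ J) ∧ cs.wordProd ω = w := by
  induction hw using Subgroup.closure_induction with
  | mem x hx =>
    obtain ⟨i, rfl⟩ := hJ hx
    exact ⟨[i], by simpa using hx, by simp⟩
  | one => exact ⟨[], by simp, by simp⟩
  | mul x y _ _ ihx ihy =>
    obtain ⟨ω, h, rfl⟩ := ihx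
    obtain ⟨ω', h', rfl⟩ := ihy
    refine ⟨ω ++ ω', ?_, by rw [wordProd_append]⟩
    intro i hi
    rcases List.mem_append.1 hi with hi | hi
    exacts [h i hi, h' i hi]
  | inv x _ ih =>
    obtain ⟨ω, h, rfl⟩ := ih
    exact ⟨ω.reverse, by simpa using h, by simp⟩

theorem exists_isReduced_subword (ω : List B) :
    ∃ ω' : List B, ω' ⊆ ω ∧ cs.IsReduced ω' ∧ cs.wordProd ω' = cs.wordProd ω := by
  induction ω with
  | nil => exact ⟨[], by simp, by simp [IsReduced], rfl⟩
  | cons i ω ih =>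
    obtain ⟨ω', hs, hr, he⟩ := ih
    rcases cs.length_simple_mul (cs.wordProd ω') i with h | h
    · refine ⟨i :: ω', List.cons_subset_cons i hs, ?_, by rw [wordProd_cons, he, wordProd_cons]⟩
      rw [IsReduced, wordProd_cons, h, hr.eq, List.length_cons]
    · obtain ⟨j, hj, hje⟩ := cs.exists_simple_mul_wordProd_eq_eraseIdx (ω := ω') (i := i)
        (by rw [IsLeftDescent]; omega)
      refine ⟨ω'.eraseIdx j, fun x hx => List.mem_cons_of_mem _
        (hs (List.mem_of_mem_eraseIdx hx)), ?_, by rw [← hje, he, wordProd_cons]⟩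
      rw [IsReduced, ← hje, List.length_eraseIdx_of_lt hj]
      have := hr.eq
      omega

theorem exists_isReduced_of_mem_closure (hJ : J ⊆ Set.range cs.simple) {w : W}
    (hw : w ∈ Subgroup.closure J) :
    ∃ ω : List B, (∀ i ∈ ω, cs.simple i ∈ J) ∧ cs.IsReduced ω ∧ cs.wordProd ω = w := by
  obtain ⟨ω, h, rfl⟩ := cs.exists_wordProd_eq_of_mem_closure hJ hw
  obtain ⟨ω', hs, hr, he⟩ := cs.exists_isReduced_subword ω
  exact ⟨ω', fun i hi => h i (hs hi), hr, he⟩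

theorem simple_mem_of_mem_closure (hJ : J ⊆ Set.range cs.simple) {i : B}
    (hi : cs.simple i ∈ Subgroup.closure J) : cs.simple i ∈ J := by
  obtain ⟨ω, h, hr, he⟩ := cs.exists_isReduced_of_mem_closure hJ hi
  have hl : ω.length = 1 := by rw [← hr.eq, he, length_simple]
  obtain ⟨j, rfl⟩ := List.length_eq_one_iff.1 hl
  rw [wordProd_singleton] at he
  rw [← he]
  exact h j (by simp)

theorem simple_mem_of_isLeftDescent (hJ : J ⊆ Set.range cs.simple) {w : W}
    (hw : w ∈ Subgroup.closure J) {i : B} (hi : cs.IsLeftDescent w i) : cs.simple i ∈ J := by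
  obtain ⟨ω, h, rfl⟩ := cs.exists_wordProd_eq_of_mem_closure hJ hw
  obtain ⟨j, -, he⟩ := cs.exists_simple_mul_wordProd_eq_eraseIdx hi
  refine cs.simple_mem_of_mem_closure hJ ?_
  rw [eq_mul_inv_of_mul_eq he]
  exact mul_mem (cs.wordProd_mem_closure fun i hi => h i (List.mem_of_mem_eraseIdx hi))
    (inv_mem hw)

theorem length_inv_wordProd_mul_add {ω : List B} (hω : cs.IsReduced ω) {w : W}
    (hw : ∀ i ∈ ω, cs.IsLeftDescent w i) :
    cs.length ((cs.wordProd ω)⁻¹ * w) + ω.length = cs.length w := by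
  induction ω with
  | nil => simp
  | cons i ω ih =>
    have hr : cs.IsReduced ω := hω.drop 1
    have ih := ih hr fun j hj => hw j (List.mem_cons_of_mem _ hj)
    obtain ⟨ζ, hζ, hz⟩ := cs.exists_isReduced ((cs.wordProd ω)⁻¹ * w)
    have hwe : w = cs.wordProd (ω ++ ζ) := by rw [wordProd_append, ← hz]; group
    have hd := hw i (by simp)
    rw [hwe] at hd
    obtain ⟨j, hj, he⟩ := cs.exists_simple_mul_wordProd_eq_eraseIdx hd
    have hlow := cs.length_le_length_mul_add_left ((cs.wordProd (i :: ω))⁻¹) w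
    rw [length_inv, hω.eq] at hlow
    rw [List.length_cons] at hlow ⊢
    rcases lt_or_ge j ω.length with hjω | hjω
    · exfalso
      rw [List.eraseIdx_append_of_lt_length hjω, wordProd_append, wordProd_append, ← mul_assoc,
        mul_left_inj, ← wordProd_cons] at he
      have h1 := cs.length_wordProd_le (ω.eraseIdx j)
      rw [← he, hω.eq, List.length_cons, List.length_eraseIdx_of_lt hjω] at h1
      omega
    · rw [List.eraseIdx_append_of_length_le hjω, ← hwe, wordProd_append] at he
      have h1 := cs.length_wordProd_le (ζ.eraseIdx (j - ω.length))
      rw [List.length_append] at hj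
      rw [List.length_eraseIdx_of_lt (by omega), ← hζ.eq, ← hz] at h1
      have h2 : (cs.wordProd (i :: ω))⁻¹ * w = cs.wordProd (ζ.eraseIdx (j - ω.length)) := by
        rw [wordProd_cons, mul_inv_rev, inv_simple, mul_assoc, he]; group
      have h3 : 0 < ζ.length := by omega
      rw [← hζ.eq, ← hz] at h3
      rw [h2] at hlow ⊢
      omega

theorem length_inv_mul_add (hJ : J ⊆ Set.range cs.simple) {w x : W}
    (hw : ∀ i, cs.simple i ∈ J → cs.IsLeftDescent w i) (hx : x ∈ Subgroup.closure J) :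
    cs.length (x⁻¹ * w) + cs.length x = cs.length w := by
  obtain ⟨ω, h, hr, rfl⟩ := cs.exists_isReduced_of_mem_closure hJ hx
  rw [hr.eq]
  exact cs.length_inv_wordProd_mul_add hr fun i hi => hw i (h i hi)

theorem finite_closure_of_isLeftDescent (hJ : J ⊆ Set.range cs.simple) {w : W}
    (hw : ∀ i, cs.simple i ∈ J → cs.IsLeftDescent w i) :
    (Subgroup.closure J : Set W).Finite := by
  have hfin : J.Finite := by
    obtain ⟨ω, rfl⟩ := cs.wordProd_surjective w
    refine (List.finite_toSet (cs.leftInvSeq ω)).subset fun x hx => ?_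
    obtain ⟨i, rfl⟩ := hJ hx
    exact cs.simple_mem_leftInvSeq (hw i hx)
  have : Finite J := hfin
  refine ((List.finite_length_le J (cs.length w)).image
    fun l => (l.map Subtype.val).prod).subset fun x hx => ?_
  obtain ⟨ω, h, hr, rfl⟩ := cs.exists_isReduced_of_mem_closure hJ hx
  refine ⟨(ω.map cs.simple).attachWith (· ∈ J) ?_, ?_, ?_⟩
  · intro x hx
    obtain ⟨i, hi, rfl⟩ := List.mem_map.1 hx
    exact h i hi
  · have := cs.length_inv_mul_add hJ hw hx
    rw [hr.eq] at this
    simp only [Set.mem_ofPred_eq, List.length_attachWith, List.length_map]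
    omega
  · simp [wordProd, Function.comp_def]

end CoxeterSystem

namespace CoxeterSystem

variable {B : Type*} {W : Type*} [Group W] {M : CoxeterMatrix B} (cs : CoxeterSystem M W)
  {φ : W ≃* W}

theorem exists_map_simple_eq (hφ : ⇑φ '' Set.range cs.simple = Set.range cs.simple) (i : B) :
    ∃ j, φ (cs.simple i) = cs.simple j := by
  have : φ (cs.simple i) ∈ Set.range cs.simple := hφ ▸ ⟨_, ⟨i, rfl⟩, rfl⟩
  obtain ⟨j, hj⟩ := this
  exact ⟨j, hj.symm⟩

theorem length_map_le (hφ : ⇑φ '' Set.range cs.simple = Set.range cs.simple) (w : W) :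
    cs.length (φ w) ≤ cs.length w := by
  have key : ∀ ω : List B, cs.length (φ (cs.wordProd ω)) ≤ ω.length := by
    intro ω
    induction ω with
    | nil => simp
    | cons i ω ih =>
      obtain ⟨j, hj⟩ := cs.exists_map_simple_eq hφ i
      rw [wordProd_cons, map_mul, hj, List.length_cons]
      have := cs.length_mul_le (cs.simple j) (φ (cs.wordProd ω))
      rw [length_simple] at this
      omega
  obtain ⟨ω, hω, rfl⟩ := cs.exists_isReduced w
  rw [hω.eq]
  exact key ω

theorem length_map (hφ : ⇑φ '' Set.range cs.simple = Set.range cs.simple)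
    (hinv : ∀ w, φ (φ w) = w) (w : W) : cs.length (φ w) = cs.length w := by
  refine le_antisymm (cs.length_map_le hφ w) ?_
  have := cs.length_map_le hφ (φ w)
  rwa [hinv] at this

theorem length_simple_mul_eq_length_mul_map
    (hφ : ⇑φ '' Set.range cs.simple = Set.range cs.simple) (hinv : ∀ w, φ (φ w) = w) {w : W}
    (hw : φ w = w⁻¹) (i : B) :
    cs.length (cs.simple i * w) = cs.length (w * φ (cs.simple i)) := by
  rw [← cs.length_map hφ hinv (cs.simple i * w), map_mul, hw, ← cs.length_inv (_ * w⁻¹),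
    mul_inv_rev, inv_inv, ← map_inv, inv_simple]

/-- The set of simple reflections which are left descents of `w`. -/
def leftDescentSet (w : W) : Set W := cs.simple '' {i | cs.IsLeftDescent w i}

theorem leftDescentSet_subset (w : W) : cs.leftDescentSet w ⊆ Set.range cs.simple :=
  Set.image_subset_range _ _

theorem isLeftDescent_of_simple_mem {w : W} {i : B} (h : cs.simple i ∈ cs.leftDescentSet w) :
    cs.IsLeftDescent w i := by
  obtain ⟨j, hj, he⟩ := h
  simp only [Set.mem_ofPred_eq, IsLeftDescent] at hj ⊢
  rwa [he] at hj

theorem mem_closure_leftDescentSet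
    (hφ : ⇑φ '' Set.range cs.simple = Set.range cs.simple) (hinv : ∀ w, φ (φ w) = w)
    {w : W} (hw : φ w = w⁻¹)
    (hd : ∀ i, cs.IsLeftDescent w i → cs.simple i * w = w * φ (cs.simple i)) :
    w ∈ Subgroup.closure (cs.leftDescentSet w) := by
  set K := cs.leftDescentSet w with hK
  obtain ⟨x, hx, hmin⟩ : ∃ x ∈ Subgroup.closure K, ∀ y ∈ Subgroup.closure K,
      cs.length (x⁻¹ * w) ≤ cs.length (y⁻¹ * w) := by
    let f : W → ℕ := fun x => cs.length (x⁻¹ * w)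
    have hne : (Subgroup.closure K : Set W).Nonempty := ⟨1, one_mem _⟩
    exact ⟨Function.argminOn f _ hne, Function.argminOn_mem f _ hne,
      fun y hy => Function.argminOn_le f _ hy⟩
  have hlen := cs.length_inv_mul_add (cs.leftDescentSet_subset w)
    (fun i hi => cs.isLeftDescent_of_simple_mem hi) hx
  by_cases h1 : x⁻¹ * w = 1
  · rw [inv_mul_eq_one] at h1
    exact h1 ▸ hx
  obtain ⟨j, hj⟩ := cs.exists_rightDescent_of_ne_one h1
  obtain ⟨i, hi⟩ := cs.exists_map_simple_eq hφ j
  have hij : φ (cs.simple i) = cs.simple j := by rw [← hi, hinv]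
  have hdi : cs.IsLeftDescent w i := by
    rw [IsLeftDescent, cs.length_simple_mul_eq_length_mul_map hφ hinv hw, hij]
    rw [IsRightDescent] at hj
    have := cs.length_mul_le x (x⁻¹ * w * cs.simple j)
    rw [show x * (x⁻¹ * w * cs.simple j) = w * cs.simple j by group] at this
    omega
  have hm := hmin (cs.simple i * x)
    (mul_mem (Subgroup.subset_closure (Set.mem_image_of_mem _ hdi)) hx)
  rw [mul_inv_rev, inv_simple, mul_assoc, hd i hdi, hij, ← mul_assoc] at hm
  rw [IsRightDescent] at hj
  omega

theorem map_image_leftDescentSet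
    (hφ : ⇑φ '' Set.range cs.simple = Set.range cs.simple) (hinv : ∀ w, φ (φ w) = w)
    {w : W} (hw : φ w = w⁻¹)
    (hd : ∀ i, cs.IsLeftDescent w i → cs.simple i * w = w * φ (cs.simple i)) :
    ⇑φ '' cs.leftDescentSet w = cs.leftDescentSet w := by
  have hsub : ⇑φ '' cs.leftDescentSet w ⊆ cs.leftDescentSet w := by
    rintro _ ⟨_, ⟨i, hi, rfl⟩, rfl⟩
    obtain ⟨j, hj⟩ := cs.exists_map_simple_eq hφ i
    have hwm := cs.mem_closure_leftDescentSet hφ hinv hw hd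
    have : φ (cs.simple i) = w⁻¹ * cs.simple i * w := by
      rw [mul_assoc, hd i hi, inv_mul_cancel_left]
    rw [hj] at this ⊢
    refine cs.simple_mem_of_mem_closure (cs.leftDescentSet_subset w) ?_
    rw [this]
    exact mul_mem (mul_mem (inv_mem hwm)
      (Subgroup.subset_closure (Set.mem_image_of_mem _ hi))) hwm
  refine hsub.antisymm fun x hx => ⟨φ x, hsub ⟨x, hx, rfl⟩, hinv x⟩

theorem map_mem_closure_of_image_eq {K : Set W} (h : ⇑φ '' K = K) {w : W}
    (hw : w ∈ Subgroup.closure K) : φ w ∈ Subgroup.closure K := by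
  rw [← h, ← MulEquiv.coe_toMonoidHom, ← MonoidHom.map_closure]
  exact Subgroup.mem_map_of_mem _ hw

end CoxeterSystem

namespace QuasiFlipTwinBuilding

variable {B : Type*} {W : Type*} [Group W] {M : CoxeterMatrix B} {cs : CoxeterSystem M W}
  {Cp : Type u} {Cm : Type v} (T : QuasiFlipTwinBuilding M cs Cp Cm)

theorem δp_self (c : Cp) : T.δp c c = 1 := (T.p_eq_one_iff c c).2 rfl

theorem δp_symm_simple {c d : Cp} {i : B} (h : T.δp c d = cs.simple i) :
    T.δp d c = cs.simple i := by
  rcases T.p_two d c d _ ⟨i, rfl⟩ h with h1 | h1 <;> rw [δp_self] at h1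
  · have : d = c := (T.p_eq_one_iff _ _).1 h1.symm
    subst this
    exact h
  · rw [eq_mul_inv_of_mul_eq h1.symm, one_mul, cs.inv_simple]

theorem mem_panel_symm {c d : Cp} {i : B} (h : d ∈ T.panel (cs.simple i) c) :
    c ∈ T.panel (cs.simple i) d := by
  rcases h with h | h
  · exact Or.inl <| (T.p_eq_one_iff _ _).2 ((T.p_eq_one_iff _ _).1 h).symm
  · exact Or.inr (T.δp_symm_simple h)

theorem mem_panel_trans {c d e : Cp} {i : B} (h : d ∈ T.panel (cs.simple i) c)
    (h' : e ∈ T.panel (cs.simple i) d) : e ∈ T.panel (cs.simple i) c := by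
  rcases h' with h' | h'
  · rwa [← (T.p_eq_one_iff _ _).1 h']
  · have h2 := T.p_two c d e _ ⟨i, rfl⟩ h'
    rcases h with h | h
    · simpa [panel, h] using h2
    · have : T.δp c e = cs.simple i ∨ T.δp c e = 1 := by simpa [h] using h2
      exact this.symm

theorem δst_adj_right (x : Cp) {y z : Cm} {i : B} (h : T.δm y z = cs.simple i) :
    T.δst x z = T.δst x y ∨ T.δst x z = T.δst x y * cs.simple i := by
  rcases cs.length_mul_simple (T.δst x y) i with hl | hl
  · obtain ⟨z', hz', he⟩ := T.tw3p x y _ ⟨i, rfl⟩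
    have hz : z ∈ T.swap.panel (cs.simple i) z' :=
      T.swap.mem_panel_trans (T.swap.mem_panel_symm (Or.inr hz')) (Or.inr h)
    rcases hz with hz | hz
    · rw [← (T.m_eq_one_iff _ _).1 hz]
      exact Or.inr he
    · left
      have := T.tw2p x z' z _ ⟨i, rfl⟩ hz (by rw [he]; simpa using hl.symm)
      rw [this, he]; simp
  · exact Or.inr (T.tw2p x y z _ ⟨i, rfl⟩ h hl)

theorem δst_eq_inv (x : Cp) (y : Cm) : T.δst x y = (T.δts y x)⁻¹ := by rw [T.tw1, inv_inv]

theorem δst_adj_left {c d : Cp} (y : Cm) {i : B} (h : T.δp c d = cs.simple i) :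
    T.δst d y = T.δst c y ∨ T.δst d y = cs.simple i * T.δst c y := by
  rcases T.swap.δst_adj_right y h with h1 | h1
  · left
    rw [δst_eq_inv, δst_eq_inv]
    exact congrArg _ h1
  · right
    rw [δst_eq_inv, δst_eq_inv, ← cs.inv_simple i, ← mul_inv_rev]
    exact congrArg _ h1

theorem δst_of_isLeftDescent {c d : Cp} (y : Cm) {i : B} (h : T.δp c d = cs.simple i)
    (hd : cs.IsLeftDescent (T.δst c y) i) : T.δst d y = cs.simple i * T.δst c y := by
  have hl : cs.length (T.δts y c * cs.simple i) + 1 = cs.length (T.δts y c) := by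
    rw [T.tw1, ← cs.isRightDescent_iff, cs.isRightDescent_inv_iff]
    exact hd
  have := T.tw2m y c d _ ⟨i, rfl⟩ h hl
  rw [δst_eq_inv, this, T.tw1, mul_inv_rev, inv_inv, cs.inv_simple]

theorem π_δθ (c : Cp) : T.π (T.δθ c) = (T.δθ c)⁻¹ := by
  rw [δθ, ← T.flip_st, T.θmθp, T.tw1]

theorem δθ_adj {c d : Cp} {i : B} (h : T.δp c d = cs.simple i) :
    T.δθ d = T.δθ c ∨ T.δθ d = T.δθ c * T.π (cs.simple i) ∨ T.δθ d = cs.simple i * T.δθ c ∨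
      T.δθ d = cs.simple i * T.δθ c * T.π (cs.simple i) := by
  obtain ⟨j, hj⟩ := cs.exists_map_simple_eq T.πS i
  have hm : T.δm (T.θp c) (T.θp d) = cs.simple j := by rw [T.flip_p, h, hj]
  rw [hj]
  have h1 := T.δst_adj_right c hm
  have h2 := T.δst_adj_left (T.θp d) h
  simp only [δθ]
  rcases h1 with h1 | h1 <;> rcases h2 with h2 | h2 <;> rw [h2, h1] <;> simp [mul_assoc]

theorem length_simple_mul_δθ (c : Cp) (i : B) :
    cs.length (cs.simple i * T.δθ c) = cs.length (T.δθ c * T.π (cs.simple i)) :=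
  cs.length_simple_mul_eq_length_mul_map T.πS T.ππ (T.π_δθ c) i

theorem simple_mul_δθ {c : Cp} {i : B}
    (h : cs.length (cs.simple i * T.δθ c * T.π (cs.simple i)) = cs.length (T.δθ c)) :
    cs.simple i * T.δθ c = T.δθ c * T.π (cs.simple i) := by
  have hl := T.length_simple_mul_δθ c i
  obtain ⟨j, hj⟩ := cs.exists_map_simple_eq T.πS i
  rw [hj] at h hl ⊢
  exact cs.simple_mul_eq_mul_simple hl h

theorem simple_mul_δθ_mul_of_length_eq {c : Cp} {i : B}
    (h : cs.length (cs.simple i * T.δθ c * T.π (cs.simple i)) = cs.length (T.δθ c)) :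
    cs.simple i * T.δθ c * T.π (cs.simple i) = T.δθ c := by
  rw [T.simple_mul_δθ h, mul_assoc, ← map_mul]
  simp

theorem δθ_eq_of_ℓθ_eq {c d : Cp} {i : B} (h : T.δp c d = cs.simple i)
    (hl : T.ℓθ d = T.ℓθ c) : T.δθ d = T.δθ c := by
  have hs := T.length_simple_mul_δθ c i
  have hne := cs.length_simple_mul_ne (T.δθ c) i
  rw [ℓθ, ℓθ] at hl
  rcases T.δθ_adj h with h1 | h1 | h1 | h1
  · exact h1
  · rw [h1] at hl; omega
  · rw [h1] at hl; omega
  · rw [h1] at hl ⊢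
    exact T.simple_mul_δθ_mul_of_length_eq hl

theorem ℓθ_le_of_not_isLeftDescent {c d : Cp} {i : B} (h : T.δp c d = cs.simple i)
    (hd : ¬ cs.IsLeftDescent (T.δθ c) i) : T.ℓθ c ≤ T.ℓθ d := by
  have hs := T.length_simple_mul_δθ c i
  rw [cs.not_isLeftDescent_iff] at hd
  rw [ℓθ, ℓθ]
  rcases T.δθ_adj h with h1 | h1 | h1 | h1 <;> rw [h1]
  · omega
  · omega
  · obtain ⟨j, hj⟩ := cs.exists_map_simple_eq T.πS i
    rw [hj]
    have := cs.length_mul_simple (cs.simple i * T.δθ c) j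
    omega

theorem δθ_eq_of_isLeftDescent_of_le {c d : Cp} {i : B} (h : T.δp c d = cs.simple i)
    (hd : cs.IsLeftDescent (T.δθ c) i) (hle : T.ℓθ c ≤ T.ℓθ d) :
    T.δθ d = T.δθ c ∧ cs.simple i * T.δθ c = T.δθ c * T.π (cs.simple i) := by
  obtain ⟨j, hj⟩ := cs.exists_map_simple_eq T.πS i
  have hm : T.δm (T.θp c) (T.θp d) = cs.simple j := by rw [T.flip_p, h, hj]
  have h1 : T.δst d (T.θp c) = cs.simple i * T.δθ c := T.δst_of_isLeftDescent _ h hd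
  rw [cs.isLeftDescent_iff] at hd
  rw [ℓθ, ℓθ] at hle
  have hd' : T.δθ d = T.δst d (T.θp d) := rfl
  rcases T.δst_adj_right d hm with h2 | h2 <;> rw [← hd', h1] at h2
  · rw [h2] at hle; omega
  · have h3 := cs.length_mul_simple (cs.simple i * T.δθ c) j
    rw [h2] at hle ⊢
    have h4 : cs.length (cs.simple i * T.δθ c * cs.simple j) = cs.length (T.δθ c) := by omega
    rw [← hj] at h4 ⊢
    exact ⟨T.simple_mul_δθ_mul_of_length_eq h4, T.simple_mul_δθ h4⟩

theorem reflTransGen_imp {α : Type*} {r p : α → α → Prop} (h : ∀ a b, r a b → p a b) {a b : α}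
    (hab : Relation.ReflTransGen r a b) : Relation.ReflTransGen p a b := by
  induction hab with
  | refl => exact .refl
  | tail _ hbc ih => exact ih.tail (h _ _ hbc)

theorem reflTransGen_symm {α : Type*} {r : α → α → Prop} (h : ∀ a b, r a b → r b a) {a b : α}
    (hab : Relation.ReflTransGen r a b) : Relation.ReflTransGen r b a := by
  induction hab with
  | refl => exact .refl
  | tail _ hbc ih => exact ih.head (h _ _ hbc)

section Galleries

variable {J J' : Set W}

theorem adjJ_symm (hJ : J ⊆ Set.range cs.simple) {c d : Cp} (h : T.adjJ J c d) :
    T.adjJ J d c := by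
  obtain ⟨j, hj, h⟩ := h
  obtain ⟨i, rfl⟩ := hJ hj
  exact ⟨_, hj, T.mem_panel_symm h⟩

theorem adjJ_mono (h : J ⊆ J') {c d : Cp} (hcd : T.adjJ J c d) : T.adjJ J' c d := by
  obtain ⟨j, hj, hcd⟩ := hcd
  exact ⟨j, h hj, hcd⟩

theorem δp_mem_closure_of_adjJ (hJ : J ⊆ Set.range cs.simple) {c d e : Cp}
    (h : T.δp c d ∈ Subgroup.closure J) (h' : T.adjJ J d e) :
    T.δp c e ∈ Subgroup.closure J := by
  obtain ⟨j, hj, h' | h'⟩ := h'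
  · rwa [← (T.p_eq_one_iff _ _).1 h']
  · rcases T.p_two c d e j (hJ hj) h' with h1 | h1 <;> rw [h1]
    · exact h
    · exact mul_mem h (Subgroup.subset_closure hj)

theorem mem_residue_iff (hJ : J ⊆ Set.range cs.simple) {c d : Cp} :
    d ∈ T.residue J c ↔ Relation.ReflTransGen (T.adjJ J) c d := by
  constructor
  · intro h
    obtain ⟨ω, hω, he⟩ := cs.exists_wordProd_eq_of_mem_closure hJ h
    induction ω using List.reverseRecOn generalizing d with
    | nil =>
      rw [(T.p_eq_one_iff _ _).1 he.symm]
    | append_singleton ω i ih =>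
      obtain ⟨z, hz, hcz⟩ := T.p_three c d _ ⟨i, rfl⟩
      rw [← he, cs.wordProd_append, cs.wordProd_singleton, cs.simple_mul_simple_cancel_right]
        at hcz
      have hω' : ∀ j ∈ ω, cs.simple j ∈ J := fun j hj => hω j (by simp [hj])
      refine (ih ?_ hω' hcz.symm).tail
        (T.adjJ_symm hJ ⟨_, hω i (by simp), Or.inr hz⟩)
      simp only [residue, Set.mem_ofPred_eq, hcz]
      exact cs.wordProd_mem_closure hω'
  · intro h
    induction h with
    | refl => simp [residue, δp_self]
    | tail _ h ih => exact T.δp_mem_closure_of_adjJ hJ ih h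

theorem mem_residue_self (c : Cp) : c ∈ T.residue J c := by simp [residue, δp_self]

theorem mem_residue_symm (hJ : J ⊆ Set.range cs.simple) {c d : Cp} (h : d ∈ T.residue J c) :
    c ∈ T.residue J d := by
  rw [T.mem_residue_iff hJ] at h ⊢
  exact reflTransGen_symm (fun _ _ => T.adjJ_symm hJ) h

theorem residue_eq_of_mem (hJ : J ⊆ Set.range cs.simple) {c d : Cp}
    (h : d ∈ T.residue J c) : T.residue J d = T.residue J c := by
  have h' := T.mem_residue_symm hJ h
  ext e
  rw [T.mem_residue_iff hJ] at h h'
  rw [T.mem_residue_iff hJ, T.mem_residue_iff hJ]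
  exact ⟨h.trans, h'.trans⟩

theorem mem_residue_of_adjJ (hJ : J ⊆ Set.range cs.simple) {a c d : Cp}
    (h : c ∈ T.residue J a) (h' : T.adjJ J c d) : d ∈ T.residue J a :=
  T.δp_mem_closure_of_adjJ hJ h h'

theorem residue_mono (h : J ⊆ J') (c : Cp) : T.residue J c ⊆ T.residue J' c :=
  fun _ hd => Subgroup.closure_mono h hd

theorem adjJ_of_mem_residue (hJ : J ⊆ Set.range cs.simple) (hne : J.Nonempty) {a c d : Cp}
    (hc : c ∈ T.residue J a) (hd : d ∈ T.residue J a)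
    (h : T.adjJ (Set.range cs.simple) c d) : T.adjJ J c d := by
  rw [← T.residue_eq_of_mem hJ hc] at hd
  obtain ⟨_, ⟨i, rfl⟩, h | h⟩ := h
  · exact ⟨hne.some, hne.some_mem, Or.inl h⟩
  · simp only [residue, Set.mem_ofPred_eq, h] at hd
    exact ⟨_, cs.simple_mem_of_mem_closure hJ hd, Or.inr h⟩

theorem mem_residue_range (c d : Cp) : d ∈ T.residue (Set.range cs.simple) c := by
  simp [residue, cs.subgroup_closure_range_simple]

theorem exists_δp_eq_of_mem_closure (hJ : J ⊆ Set.range cs.simple) (c : Cp) {w : W}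
    (hw : w ∈ Subgroup.closure J) : ∃ d, T.δp c d = w := by
  obtain ⟨ω, -, rfl⟩ := cs.exists_wordProd_eq_of_mem_closure hJ hw
  clear hw
  induction ω using List.reverseRecOn with
  | nil => exact ⟨c, by simp [δp_self]⟩
  | append_singleton ω i ih =>
    obtain ⟨d, hd⟩ := ih
    obtain ⟨e, -, he⟩ := T.p_three c d _ ⟨i, rfl⟩
    exact ⟨e, by rw [he, hd, cs.wordProd_append, cs.wordProd_singleton]⟩

theorem type_eq_of_residue_eq (hJ : J ⊆ Set.range cs.simple) (hJ' : J' ⊆ Set.range cs.simple)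
    {c : Cp} (h : T.residue J c = T.residue J' c) : J = J' := by
  have key : ∀ {I I' : Set W}, I ⊆ Set.range cs.simple → I' ⊆ Set.range cs.simple →
      T.residue I c = T.residue I' c → I ⊆ I' := by
    intro I I' hI hI' h s hs
    obtain ⟨i, rfl⟩ := hI hs
    obtain ⟨d, hd⟩ := T.exists_δp_eq_of_mem_closure hI c (Subgroup.subset_closure hs)
    have : d ∈ T.residue I' c := by
      rw [← h]
      simp only [residue, Set.mem_ofPred_eq, hd]
      exact Subgroup.subset_closure hs
    simp only [residue, Set.mem_ofPred_eq, hd] at this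
    exact cs.simple_mem_of_mem_closure hI' this
  exact (key hJ hJ' h).antisymm (key hJ' hJ h.symm)

end Galleries

/-- A list of elements of `X` in which consecutive entries are related gives a path in `X`. -/
theorem reflTransGen_of_list {α : Type*} {r : α → α → Prop} {X : Set α} {γ : List α} {c d : α}
    (hc : γ.head? = some c) (hd : γ.getLast? = some d) (hγ : γ.IsChain r)
    (hX : ∀ x ∈ γ, x ∈ X) :
    c ∈ X ∧ Relation.ReflTransGen (fun a b => r a b ∧ a ∈ X ∧ b ∈ X) c d := by
  induction γ generalizing c with
  | nil => simp at hc
  | cons a γ ih =>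
    obtain rfl : a = c := by simpa using hc
    refine ⟨hX _ (by simp), ?_⟩
    cases γ with
    | nil =>
      obtain rfl : a = d := by simpa using hd
      exact .refl
    | cons b γ =>
      rw [List.isChain_cons_cons] at hγ
      obtain ⟨hb, hp⟩ := ih rfl (by simpa using hd) hγ.2 fun x hx => hX x (by simp_all)
      exact .head ⟨hγ.1, hX _ (by simp), hb⟩ hp

theorem galleryIn_of_reflTransGen {X : Set Cp} {J : Set W} {c d : Cp} (hc : c ∈ X)
    (h : Relation.ReflTransGen (fun a b => T.adjJ J a b ∧ b ∈ X) c d) :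
    T.GalleryIn X J c d := by
  induction h using Relation.ReflTransGen.head_induction_on with
  | refl => exact ⟨[d], rfl, rfl, .singleton _, by simpa using hc⟩
  | head h _ ih =>
    obtain ⟨γ, hγ, hd, hch, hX⟩ := ih h.2
    cases γ with
    | nil => simp at hγ
    | cons b γ =>
      obtain rfl : b = _ := by simpa using hγ
      refine ⟨_ :: b :: γ, rfl, by simpa using hd, List.isChain_cons_cons.2 ⟨h.1, hch⟩, ?_⟩
      intro x hx
      rcases List.mem_cons.1 hx with rfl | hx
      exacts [hc, hX x hx]

theorem exists_lower_of_directDescent {R : Set Cp} (h : T.DirectDescent R) {c : Cp}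
    (hc : c ∈ R) (hc' : c ∉ T.flipflop R) :
    ∃ d ∈ R, T.adjJ (Set.range cs.simple) c d ∧ T.ℓθ d < T.ℓθ c := by
  obtain ⟨γ, hγ, ⟨e, hγe, he⟩, hadj, hlt, hX⟩ := h c hc
  rcases γ with - | ⟨a, - | ⟨b, γ⟩⟩
  · simp at hγ
  · obtain rfl : a = c := by simpa using hγ
    obtain rfl : a = e := by simpa using hγe
    exact absurd he hc'
  · obtain rfl : a = c := by simpa using hγ
    exact ⟨b, hX b (by simp), (List.isChain_cons_cons.1 hadj).1,
      (List.isChain_cons_cons.1 hlt).1⟩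

/-- Adjacency of type `J` between chambers of numerical `θ`-codistance at most `n`. -/
def adjLE (J : Set W) (n : ℕ) (a b : Cp) : Prop := T.adjJ J a b ∧ T.ℓθ a ≤ n ∧ T.ℓθ b ≤ n

theorem adjLE_symm {J : Set W} (hJ : J ⊆ Set.range cs.simple) {n : ℕ} {a b : Cp}
    (h : T.adjLE J n a b) : T.adjLE J n b a :=
  ⟨T.adjJ_symm hJ h.1, h.2.2, h.2.1⟩

theorem adjLE_mono {J J' : Set W} (hJ : J ⊆ J') {n m : ℕ} (hn : n ≤ m) {a b : Cp}
    (h : T.adjLE J n a b) : T.adjLE J' m a b :=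
  ⟨T.adjJ_mono hJ h.1, h.2.1.trans hn, h.2.2.trans hn⟩

section Residues

variable {J : Set W} {a : Cp}

theorem exists_flipflop_of_directDescent (hJ : J ⊆ Set.range cs.simple) (hne : J.Nonempty)
    (h : T.DirectDescent (T.residue J a)) {n : ℕ} {c : Cp} (hc : c ∈ T.residue J a)
    (hn : T.ℓθ c ≤ n) :
    ∃ e ∈ T.flipflop (T.residue J a), Relation.ReflTransGen (T.adjLE J n) c e := by
  by_cases hc' : c ∈ T.flipflop (T.residue J a)
  · exact ⟨c, hc', .refl⟩
  · obtain ⟨d, hd, hcd, hlt⟩ := T.exists_lower_of_directDescent h hc hc'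
    obtain ⟨e, he, hde⟩ := exists_flipflop_of_directDescent hJ hne h hd (hlt.le.trans hn)
    exact ⟨e, he, hde.head ⟨T.adjJ_of_mem_residue hJ hne hc hd hcd, hn, hlt.le.trans hn⟩⟩
termination_by T.ℓθ c

theorem reflTransGen_adjLE_of_mem_residue (hJ : J ⊆ Set.range cs.simple) (hne : J.Nonempty)
    (h : T.DirectDescent (T.residue J a)) (h' : T.ConnectedFF (T.residue J a)) {n : ℕ}
    {c d : Cp} (hc : c ∈ T.residue J a) (hd : d ∈ T.residue J a) (hcn : T.ℓθ c ≤ n)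
    (hdn : T.ℓθ d ≤ n) : Relation.ReflTransGen (T.adjLE J n) c d := by
  obtain ⟨e, he, hce⟩ := T.exists_flipflop_of_directDescent hJ hne h hc hcn
  obtain ⟨f, hf, hdf⟩ := T.exists_flipflop_of_directDescent hJ hne h hd hdn
  obtain ⟨γ, hγe, hγf, hadj, hX⟩ := h' e he f hf
  have hle : ∀ x ∈ T.flipflop (T.residue J a), T.ℓθ x ≤ n := fun x hx => (hx.2 c hc).trans hcn
  refine (hce.trans ?_).trans
    (reflTransGen_symm (fun _ _ => T.adjLE_symm hJ) hdf)
  refine reflTransGen_imp (fun x y hxy => ?_) (reflTransGen_of_list hγe hγf hadj hX).2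
  exact ⟨T.adjJ_of_mem_residue hJ hne hxy.2.1.1 hxy.2.2.1 hxy.1, hle x hxy.2.1, hle y hxy.2.2⟩

end Residues

/-- Rank two residues admit direct descent into a connected flip-flop system. -/
def RankTwoDescent : Prop :=
  ∀ (J : Set W) (c : Cp), J ⊆ Set.range cs.simple → J.ncard = 2 →
    T.DirectDescent (T.residue J c) ∧ T.ConnectedFF (T.residue J c)

variable {T}

theorem RankTwoDescent.exists_of_adjLE_succ (h2 : T.RankTwoDescent) {J : Set W}
    (hJ : J ⊆ Set.range cs.simple) {m : ℕ} {c d : Cp} (hc : T.ℓθ c ≤ m)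
    (h : Relation.ReflTransGen (T.adjLE J (m + 1)) c d) :
    ∃ d', T.ℓθ d' ≤ m ∧ Relation.ReflTransGen (T.adjLE J m) c d' ∧
      (d' = d ∨ T.adjJ J d' d) := by
  induction h with
  | refl => exact ⟨c, hc, .refl, Or.inl rfl⟩
  | @tail d e _ hde ih =>
    obtain ⟨d', hd', hcd', rfl | hadj⟩ := ih
    · exact ⟨d', hd', hcd', Or.inr hde.1⟩
    by_cases hdm : T.ℓθ d ≤ m
    · exact ⟨d, hdm, hcd'.tail ⟨hadj, hd', hdm⟩, Or.inr hde.1⟩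
    obtain ⟨⟨t, htJ, ht⟩, hd1, he1⟩ := hde
    obtain ⟨s, hsJ, hs⟩ := hadj
    by_cases hst : s = t
    · subst hst
      obtain ⟨i, rfl⟩ := hJ hsJ
      exact ⟨d', hd', hcd', Or.inr ⟨_, hsJ, T.mem_panel_trans hs ht⟩⟩
    have hsub : ({s, t} : Set W) ⊆ J := Set.pair_subset hsJ htJ
    have hS := hsub.trans hJ
    have hne : ({s, t} : Set W).Nonempty := Set.insert_nonempty _ _
    obtain ⟨hdd, hconn⟩ := h2 {s, t} d' hS (Set.ncard_pair hst)
    have hd'R : d' ∈ T.residue {s, t} d' := T.mem_residue_self d'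
    have hdR : d ∈ T.residue {s, t} d' := T.mem_residue_of_adjJ hS hd'R ⟨s, by simp, hs⟩
    have heR : e ∈ T.residue {s, t} d' := T.mem_residue_of_adjJ hS hdR ⟨t, by simp, ht⟩
    have hpath : ∀ x ∈ T.residue {s, t} d', T.ℓθ x ≤ m →
        Relation.ReflTransGen (T.adjLE J m) c x := fun x hx hxm =>
      hcd'.trans (reflTransGen_imp (fun _ _ => T.adjLE_mono hsub le_rfl)
        (T.reflTransGen_adjLE_of_mem_residue hS hne hdd hconn hd'R hx hd' hxm))
    by_cases hem : T.ℓθ e ≤ m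
    · exact ⟨e, hem, hpath e heR hem, Or.inl rfl⟩
    · obtain ⟨e', he'R, hee', hlt⟩ := T.exists_lower_of_directDescent hdd heR
        fun hmin => hem ((hmin.2 d' hd'R).trans hd')
      have he'm : T.ℓθ e' ≤ m := by omega
      exact ⟨e', he'm, hpath e' he'R he'm, Or.inr (T.adjJ_mono hsub
        (T.adjJ_symm hS (T.adjJ_of_mem_residue hS hne heR he'R hee')))⟩

theorem RankTwoDescent.adjLE_of_adjLE_succ (h2 : T.RankTwoDescent) {J : Set W}
    (hJ : J ⊆ Set.range cs.simple) {m : ℕ} {c d : Cp} (hc : T.ℓθ c ≤ m) (hd : T.ℓθ d ≤ m)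
    (h : Relation.ReflTransGen (T.adjLE J (m + 1)) c d) :
    Relation.ReflTransGen (T.adjLE J m) c d := by
  obtain ⟨d', hd', hcd', rfl | hadj⟩ := h2.exists_of_adjLE_succ hJ hc h
  · exact hcd'
  · exact hcd'.tail ⟨hadj, hd', hd⟩

theorem RankTwoDescent.adjLE_of_reflTransGen (h2 : T.RankTwoDescent) {J : Set W}
    (hJ : J ⊆ Set.range cs.simple) {m : ℕ} {c d : Cp} (hc : T.ℓθ c ≤ m) (hd : T.ℓθ d ≤ m)
    (h : Relation.ReflTransGen (T.adjJ J) c d) :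
    Relation.ReflTransGen (T.adjLE J m) c d := by
  obtain ⟨k, hk⟩ : ∃ k, Relation.ReflTransGen (T.adjLE J (m + k)) c d := by
    clear hd
    induction h with
    | refl => exact ⟨0, .refl⟩
    | @tail b d _ hbd ih =>
      obtain ⟨k, hk⟩ := ih
      refine ⟨k + T.ℓθ b + T.ℓθ d, (reflTransGen_imp
        (fun _ _ => T.adjLE_mono subset_rfl (by omega)) hk).tail ⟨hbd, by omega, by omega⟩⟩
  induction k with
  | zero => exact hk
  | succ k ih => exact ih (h2.adjLE_of_adjLE_succ hJ (by omega) (by omega) hk)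

variable (T) in
/-- A chamber none of whose neighbours has smaller numerical `θ`-codistance. -/
def IsLocalMin (c : Cp) : Prop :=
  ∀ d, T.adjJ (Set.range cs.simple) c d → T.ℓθ c ≤ T.ℓθ d

theorem RankTwoDescent.isLocalMin_of_adj (h2 : T.RankTwoDescent) {c d : Cp}
    (hc : T.IsLocalMin c) (hadj : T.adjJ (Set.range cs.simple) c d) (hl : T.ℓθ d = T.ℓθ c) :
    T.IsLocalMin d := by
  rintro e ⟨t, htS, ht⟩
  rw [hl]
  obtain ⟨s, hsS, hs⟩ := hadj
  by_cases hst : s = t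
  · subst hst
    obtain ⟨i, rfl⟩ := hsS
    exact hc e ⟨_, ⟨i, rfl⟩, T.mem_panel_trans hs ht⟩
  have hS : ({s, t} : Set W) ⊆ Set.range cs.simple := Set.pair_subset hsS htS
  obtain ⟨hdd, -⟩ := h2 {s, t} c hS (Set.ncard_pair hst)
  have hcR : c ∈ T.residue {s, t} c := T.mem_residue_self c
  have hdR : d ∈ T.residue {s, t} c := T.mem_residue_of_adjJ hS hcR ⟨s, by simp, hs⟩
  have heR : e ∈ T.residue {s, t} c := T.mem_residue_of_adjJ hS hdR ⟨t, by simp, ht⟩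
  by_cases hmin : c ∈ T.flipflop (T.residue {s, t} c)
  · exact hmin.2 e heR
  · obtain ⟨x, -, hx, hlt⟩ := T.exists_lower_of_directDescent hdd hcR hmin
    exact absurd (hc x hx) (by omega)

theorem RankTwoDescent.mem_flipflop_of_isLocalMin (h2 : T.RankTwoDescent) {c : Cp}
    (hc : T.IsLocalMin c) : c ∈ T.flipflop Set.univ := by
  refine ⟨Set.mem_univ _, fun d hd => ?_⟩
  clear hd
  by_contra! hlt
  have hp := h2.adjLE_of_reflTransGen subset_rfl le_rfl hlt.le
    ((T.mem_residue_iff subset_rfl).1 (T.mem_residue_range c d))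
  have : T.IsLocalMin d ∧ T.ℓθ d = T.ℓθ c := by
    clear hlt
    induction hp with
    | refl => exact ⟨hc, rfl⟩
    | tail _ h ih =>
      have hl : T.ℓθ _ = T.ℓθ c := le_antisymm h.2.2 (ih.2 ▸ ih.1 _ h.1)
      exact ⟨h2.isLocalMin_of_adj ih.1 h.1 (hl.trans ih.2.symm), hl⟩
  omega

variable (T) in
theorem δθ_eq_of_adjJ {J : Set W} (hJ : J ⊆ Set.range cs.simple) {c d : Cp}
    (h : T.adjJ J c d) (hl : T.ℓθ d = T.ℓθ c) : T.δθ d = T.δθ c := by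
  obtain ⟨s, hs, h | h⟩ := h
  · rw [(T.p_eq_one_iff _ _).1 h]
  · obtain ⟨i, rfl⟩ := hJ hs
    exact T.δθ_eq_of_ℓθ_eq h hl

theorem ℓθ_eq_of_mem_flipflop_univ {c d : Cp} (hc : c ∈ T.flipflop Set.univ)
    (hd : d ∈ T.flipflop Set.univ) : T.ℓθ c = T.ℓθ d :=
  le_antisymm (hc.2 _ trivial) (hd.2 _ trivial)

theorem RankTwoDescent.reflTransGen_flipflop (h2 : T.RankTwoDescent) {J : Set W}
    (hJ : J ⊆ Set.range cs.simple) {c d : Cp} (hc : c ∈ T.flipflop Set.univ)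
    (hd : d ∈ T.flipflop Set.univ) (h : Relation.ReflTransGen (T.adjJ J) c d) :
    Relation.ReflTransGen (fun a b => T.adjJ J a b ∧ b ∈ T.flipflop Set.univ) c d :=
  reflTransGen_imp (fun _ _ h => ⟨h.1, trivial, fun x _ => h.2.2.trans (hc.2 x trivial)⟩)
    (h2.adjLE_of_reflTransGen hJ le_rfl (ℓθ_eq_of_mem_flipflop_univ hd hc).le h)

theorem RankTwoDescent.δθ_eq (h2 : T.RankTwoDescent) {c d : Cp}
    (hc : c ∈ T.flipflop Set.univ) (hd : d ∈ T.flipflop Set.univ) : T.δθ d = T.δθ c := by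
  have hp := h2.reflTransGen_flipflop subset_rfl hc hd
    ((T.mem_residue_iff subset_rfl).1 (T.mem_residue_range c d))
  have : d ∈ T.flipflop Set.univ ∧ T.δθ d = T.δθ c := by
    clear hd
    induction hp with
    | refl => exact ⟨hc, rfl⟩
    | tail _ h ih =>
      exact ⟨h.2, (T.δθ_eq_of_adjJ subset_rfl h.1
        (ℓθ_eq_of_mem_flipflop_univ h.2 ih.1)).trans ih.2⟩
  exact this.2

variable (T)

theorem simple_mul_δθ_of_mem_flipflop {c : Cp} (hc : c ∈ T.flipflop Set.univ) {i : B}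
    (hi : cs.IsLeftDescent (T.δθ c) i) :
    cs.simple i * T.δθ c = T.δθ c * T.π (cs.simple i) := by
  obtain ⟨d, hd, -⟩ := T.p_three c c _ ⟨i, rfl⟩
  exact (T.δθ_eq_of_isLeftDescent_of_le hd hi (hc.2 d trivial)).2

theorem mem_flipflop_of_mem_residue {c d : Cp} (hc : c ∈ T.flipflop Set.univ)
    (hd : d ∈ T.residue (cs.leftDescentSet (T.δθ c)) c) :
    d ∈ T.flipflop Set.univ ∧ T.δθ d = T.δθ c := by
  have hS := cs.leftDescentSet_subset (T.δθ c)
  rw [T.mem_residue_iff hS] at hd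
  induction hd with
  | refl => exact ⟨hc, rfl⟩
  | @tail d e _ h ih =>
    obtain ⟨s, hs, h | h⟩ := h
    · rwa [← (T.p_eq_one_iff _ _).1 h]
    · obtain ⟨i, rfl⟩ := hS hs
      have hi := cs.isLeftDescent_of_simple_mem hs
      rw [← ih.2] at hi
      have he := (T.δθ_eq_of_isLeftDescent_of_le h hi (ih.1.2 e trivial)).1
      refine ⟨⟨trivial, fun x hx => ?_⟩, he.trans ih.2⟩
      rw [ℓθ, he]
      exact ih.1.2 x hx

theorem exists_δst_eq_mul {J : Set W} (hJ : J ⊆ Set.range cs.simple) (x : Cp) (y : Cm) {w : W}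
    (hw : w ∈ Subgroup.closure J) :
    ∃ z, T.δm y z ∈ Subgroup.closure J ∧ T.δst x z = T.δst x y * w := by
  obtain ⟨ω, hω, rfl⟩ := cs.exists_wordProd_eq_of_mem_closure hJ hw
  clear hw
  induction ω using List.reverseRecOn with
  | nil => exact ⟨y, by rw [(T.m_eq_one_iff y y).2 rfl]; exact one_mem _, by simp⟩
  | append_singleton ω i ih =>
    obtain ⟨z, hz, hxz⟩ := ih fun j hj => hω j (by simp [hj])
    obtain ⟨z', hzz', hxz'⟩ := T.tw3p x z _ ⟨i, rfl⟩
    refine ⟨z', T.swap.δp_mem_closure_of_adjJ hJ hz ⟨_, hω i (by simp), Or.inr hzz'⟩, ?_⟩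
    rw [hxz', hxz, cs.wordProd_append, cs.wordProd_singleton, mul_assoc]

theorem inv_mul_δst_mem_closure {J : Set W} (hJ : J ⊆ Set.range cs.simple) (x : Cp) {y z : Cm}
    (h : T.δm y z ∈ Subgroup.closure J) :
    (T.δst x y)⁻¹ * T.δst x z ∈ Subgroup.closure J := by
  have h' : Relation.ReflTransGen (T.swap.adjJ J) y z := (T.swap.mem_residue_iff hJ).1 h
  clear h
  induction h' with
  | refl => simp
  | @tail z z' _ h ih =>
    obtain ⟨s, hs, h | h⟩ := h
    · rwa [← (T.m_eq_one_iff z z').1 h]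
    · obtain ⟨i, rfl⟩ := hJ hs
      rcases T.δst_adj_right x h with h1 | h1 <;> rw [h1]
      · exact ih
      · rw [← mul_assoc]
        exact mul_mem ih (Subgroup.subset_closure hs)

theorem opp_symm {c d : Cp} (h : T.Opp c (T.θp d)) : T.Opp d (T.θp c) := by
  have h1 := T.flip_st c (T.θp d)
  rw [T.θmθp, h, map_one, T.tw1, inv_eq_one] at h1
  exact h1

variable {T}

/-- A chamber of a Phan residue of type `J` has its `θ`-codistance in the subgroup
generated by `J`. -/
theorem IsPhan.δθ_mem_closure {J : Set W} (hJ : J ⊆ Set.range cs.simple) {R : Set Cp}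
    (hR : T.IsPhan J R) {c : Cp} (hc : c ∈ R) : T.δθ c ∈ Subgroup.closure J := by
  obtain ⟨⟨a, rfl⟩, h, -⟩ := hR
  obtain ⟨d, hd, hopp⟩ := h c hc
  rw [← T.residue_eq_of_mem hJ hc] at hd
  have hJ' : ⇑T.π '' J ⊆ Set.range cs.simple := by
    rw [← T.πS]
    exact Set.image_mono hJ
  have hm : T.δm (T.θp c) (T.θp d) ∈ Subgroup.closure (⇑T.π '' J) := by
    rw [T.flip_p, ← MulEquiv.coe_toMonoidHom, ← MonoidHom.map_closure]
    exact Subgroup.mem_map_of_mem _ hd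
  have hw := T.inv_mul_δst_mem_closure hJ' c hm
  rw [hopp, mul_one, ← MulEquiv.coe_toMonoidHom, ← MonoidHom.map_closure] at hw
  obtain ⟨u, hu, he⟩ := hw
  have he : T.π u = (T.δθ c)⁻¹ := he
  rw [← T.π_δθ] at he
  rwa [← T.π.injective he]

theorem RankTwoDescent.exists_mem_flipflop_of_isPhan (h2 : T.RankTwoDescent) {J : Set W}
    (hJ : J ⊆ Set.range cs.simple) {R : Set Cp} (hR : T.IsPhan J R) :
    ∃ c ∈ R, c ∈ T.flipflop Set.univ := by
  have hne : R.Nonempty := by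
    obtain ⟨⟨a, rfl⟩, -⟩ := hR
    exact ⟨a, T.mem_residue_self a⟩
  set c := Function.argminOn T.ℓθ R hne
  have hc : c ∈ R := Function.argminOn_mem _ _ _
  have hmin : ∀ d ∈ R, T.ℓθ c ≤ T.ℓθ d := fun d hd => Function.argminOn_le _ _ hd
  refine ⟨c, hc, h2.mem_flipflop_of_isLocalMin ?_⟩
  rintro d ⟨_, ⟨i, rfl⟩, h | h⟩
  · rw [(T.p_eq_one_iff _ _).1 h]
  · by_cases hi : cs.IsLeftDescent (T.δθ c) i
    · have hiJ := cs.simple_mem_of_isLeftDescent hJ (hR.δθ_mem_closure hJ hc) hi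
      obtain ⟨⟨a, rfl⟩, -⟩ := hR
      exact hmin d (T.mem_residue_of_adjJ hJ hc ⟨_, hiJ, Or.inr h⟩)
    · exact T.ℓθ_le_of_not_isLeftDescent h hi

theorem isPhan_residue_leftDescentSet {c : Cp} (hc : c ∈ T.flipflop Set.univ) :
    T.IsPhan (cs.leftDescentSet (T.δθ c)) (T.residue (cs.leftDescentSet (T.δθ c)) c) := by
  set K := cs.leftDescentSet (T.δθ c) with hK
  have hS : K ⊆ Set.range cs.simple := cs.leftDescentSet_subset _
  have hw : T.δθ c ∈ Subgroup.closure K := cs.mem_closure_leftDescentSet T.πS T.ππ (T.π_δθ c)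
    fun i hi => T.simple_mul_δθ_of_mem_flipflop hc hi
  have hKθ : ⇑T.π '' K = K := cs.map_image_leftDescentSet T.πS T.ππ (T.π_δθ c)
    fun i hi => T.simple_mul_δθ_of_mem_flipflop hc hi
  have key : ∀ r ∈ T.residue K c, ∃ r' ∈ T.residue K c, T.Opp r (T.θp r') := by
    intro r hr
    have hrw : T.δst r (T.θp r) = T.δθ c := (T.mem_flipflop_of_mem_residue hc hr).2
    obtain ⟨z, hz, he⟩ := T.exists_δst_eq_mul hS r (T.θp r) (inv_mem hw)
    refine ⟨T.θm z, ?_, by rw [Opp, T.θpθm, he, hrw, mul_inv_cancel]⟩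
    rw [← T.residue_eq_of_mem hS hr]
    have : T.δp r (T.θm z) = T.π (T.δm (T.θp r) z) := by rw [← T.flip_m, T.θmθp]
    simp only [residue, Set.mem_ofPred_eq, this]
    exact CoxeterSystem.map_mem_closure_of_image_eq hKθ hz
  refine ⟨⟨c, rfl⟩, key, fun r hr => ?_⟩
  obtain ⟨r', hr', h⟩ := key r hr
  exact ⟨r', hr', T.opp_symm h⟩

theorem isMinPhan_residue_leftDescentSet {c : Cp} (hc : c ∈ T.flipflop Set.univ) :
    T.IsMinPhan (cs.leftDescentSet (T.δθ c)) (T.residue (cs.leftDescentSet (T.δθ c)) c) := by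
  refine ⟨isPhan_residue_leftDescentSet hc, fun J R hJ hR hsub => hsub.antisymm ?_⟩
  have hS := cs.leftDescentSet_subset (T.δθ c)
  obtain ⟨a, rfl⟩ := hR.1
  have ha := T.mem_residue_self (J := J) a
  have hw := hR.δθ_mem_closure hJ ha
  rw [(T.mem_flipflop_of_mem_residue hc (hsub ha)).2] at hw
  rw [← T.residue_eq_of_mem hS (hsub ha)]
  refine T.residue_mono ?_ a
  rintro _ ⟨i, hi, rfl⟩
  exact cs.simple_mem_of_isLeftDescent hJ hw hi

theorem RankTwoDescent.eq_residue_of_isMinPhan (h2 : T.RankTwoDescent) {J : Set W}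
    (hJ : J ⊆ Set.range cs.simple) {R : Set Cp} (hR : T.IsMinPhan J R) :
    ∃ c ∈ T.flipflop Set.univ, R = T.residue (cs.leftDescentSet (T.δθ c)) c ∧
      J = cs.leftDescentSet (T.δθ c) := by
  obtain ⟨c, hcR, hc⟩ := h2.exists_mem_flipflop_of_isPhan hJ hR.1
  have hS := cs.leftDescentSet_subset (T.δθ c)
  have hw := hR.1.δθ_mem_closure hJ hcR
  have hRc : R = T.residue J c := by
    obtain ⟨a, ha⟩ := hR.1.1
    rw [ha] at hcR ⊢
    exact (T.residue_eq_of_mem hJ hcR).symm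
  have hsub : cs.leftDescentSet (T.δθ c) ⊆ J := by
    rintro _ ⟨i, hi, rfl⟩
    exact cs.simple_mem_of_isLeftDescent hJ hw hi
  have he : T.residue (cs.leftDescentSet (T.δθ c)) c = R :=
    hR.2 _ _ hS (isPhan_residue_leftDescentSet hc) (hRc ▸ T.residue_mono hsub c)
  exact ⟨c, hc, he.symm, T.type_eq_of_residue_eq hJ hS (hRc.symm.trans he.symm)⟩

end QuasiFlipTwinBuilding

open QuasiFlipTwinBuilding in
/-- Suppose every rank-two residue `R` (in either half) admits direct descent into a
connected `R^θ`.  Then there exists a spherical `θ`-stable subset `K ⊆ S` such that: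
every minimal Phan residue of the (positive) half has type `K`; the `θ`-codistance is
constant on the flip-flop system `C^θ`, with value the longest element `w_K` of
`(W_K, K)`; `C^θ` equals the union of the minimal Phan residues; and `C^θ` inherits
connectedness from the half: any two chambers of `C^θ` joined by a `J`-gallery in the
half are joined by a `J`-gallery in `C^θ`. -/
theorem flipflop_homogeneous_and_inherits_connectedness
    {B : Type*} {W : Type*} [Group W] {M : CoxeterMatrix B} {cs : CoxeterSystem M W}
    {Cp : Type u} {Cm : Type v} (T : QuasiFlipTwinBuilding M cs Cp Cm)
    (h2p : ∀ (J : Set W) (c : Cp), J ⊆ Set.range cs.simple → J.ncard = 2 →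
      T.DirectDescent (T.residue J c) ∧ T.ConnectedFF (T.residue J c))
    (h2m : ∀ (J : Set W) (c : Cm), J ⊆ Set.range cs.simple → J.ncard = 2 →
      T.swap.DirectDescent (T.swap.residue J c) ∧ T.swap.ConnectedFF (T.swap.residue J c)) :
    ∃ K ⊆ Set.range cs.simple,
      ⇑T.π '' K = K ∧
      (Subgroup.closure K : Set W).Finite ∧
      (∀ (I : Set W) (R : Set Cp), I ⊆ Set.range cs.simple →
        T.IsMinPhan I R → I = K) ∧
      (∃ wK ∈ Subgroup.closure K,
        (∀ u ∈ Subgroup.closure K, cs.length u ≤ cs.length wK) ∧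
        ∀ c ∈ T.flipflop Set.univ, T.δθ c = wK) ∧
      (T.flipflop Set.univ =
        {c : Cp | ∃ (I : Set W) (R : Set Cp), I ⊆ Set.range cs.simple ∧
          T.IsMinPhan I R ∧ c ∈ R}) ∧
      (∀ J : Set W, J ⊆ Set.range cs.simple →
        ∀ c ∈ T.flipflop Set.univ, ∀ d ∈ T.flipflop Set.univ,
          T.GalleryIn Set.univ J c d → T.GalleryIn (T.flipflop Set.univ) J c d) := by
  have h2 : T.RankTwoDescent := h2p
  have : Nonempty Cp := T.nonempty_p
  obtain ⟨c₀, hc₀⟩ : (T.flipflop Set.univ).Nonempty :=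
    ⟨Function.argmin T.ℓθ, trivial, fun d _ => Function.argmin_le T.ℓθ d⟩
  have hcomm : ∀ i, cs.IsLeftDescent (T.δθ c₀) i →
      cs.simple i * T.δθ c₀ = T.δθ c₀ * T.π (cs.simple i) :=
    fun i hi => T.simple_mul_δθ_of_mem_flipflop hc₀ hi
  have hS := cs.leftDescentSet_subset (T.δθ c₀)
  have hdesc : ∀ i, cs.simple i ∈ cs.leftDescentSet (T.δθ c₀) →
      cs.IsLeftDescent (T.δθ c₀) i := fun i hi => cs.isLeftDescent_of_simple_mem hi
  refine ⟨cs.leftDescentSet (T.δθ c₀), hS,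
    cs.map_image_leftDescentSet T.πS T.ππ (T.π_δθ c₀) hcomm,
    cs.finite_closure_of_isLeftDescent hS hdesc, ?_,
    ⟨T.δθ c₀, cs.mem_closure_leftDescentSet T.πS T.ππ (T.π_δθ c₀) hcomm, ?_,
      fun c hc => h2.δθ_eq hc₀ hc⟩, ?_, ?_⟩
  · intro I R hI hR
    obtain ⟨c, hc, -, rfl⟩ := h2.eq_residue_of_isMinPhan hI hR
    rw [h2.δθ_eq hc₀ hc]
  · intro u hu
    have := cs.length_inv_mul_add hS hdesc hu
    omega
  · ext c
    constructor
    · intro hc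
      exact ⟨_, _, cs.leftDescentSet_subset _, isMinPhan_residue_leftDescentSet hc,
        T.mem_residue_self c⟩
    · rintro ⟨I, R, hI, hR, hcR⟩
      obtain ⟨d, hd, rfl, -⟩ := h2.eq_residue_of_isMinPhan hI hR
      exact (T.mem_flipflop_of_mem_residue hd hcR).1
  · rintro J hJ c hc d hd ⟨γ, hγc, hγd, hγ, hX⟩
    exact T.galleryIn_of_reflTransGen hc (h2.reflTransGen_flipflop hJ hc hd
      (reflTransGen_imp (fun _ _ h => h.1) (reflTransGen_of_list hγc hγd hγ hX).2))
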